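/- arXiv:1003.0767 — 4 statements merged into one kernel-verified Lean document; each statement's English description precedes it below -/
import Mathlib

section
/- Let E be a symmetric 3×3 real matrix and ζ ∈ ℝ³. Let σ_{E,ζ} be the linear endomorphism of the (6-dimensional) real vector space of symmetric 3×3 matrices defined by σ_{E,ζ}(v) = tr(Ev)·ζζᵀ + (ζᵀEζ)·v − ζ(vEζ)ᵀ − (vEζ)ζᵀ. Then σ_{E,ζ} ∘ σ_{E,ζ} = (ζᵀEζ) · σ_{E,ζ}. Consequently every eigenvalue of σ_{E,ζ} lies in {0, ζᵀEζ}; in particular, if ζᵀEζ ≥ 0 then all eigenvalues of σ_{E,ζ} are nonnegative. -/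
open Matrix

/-- The (6-dimensional) subspace of symmetric 3×3 real matrices. -/
def symMat3 : Submodule ℝ (Matrix (Fin 3) (Fin 3) ℝ) where
  carrier := {A | A.IsSymm}
  add_mem' := fun ha hb => ha.add hb
  zero_mem' := Matrix.isSymm_zero
  smul_mem' := fun c _ h => h.smul c

/-- The map `v ↦ tr(Ev)·ζζᵀ + (ζᵀEζ)·v − ζ(vEζ)ᵀ − (vEζ)ζᵀ` on 3×3 matrices,
as a linear map. -/
noncomputable def sigmaMap (E : Matrix (Fin 3) (Fin 3) ℝ) (ζ : Fin 3 → ℝ) :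
    Matrix (Fin 3) (Fin 3) ℝ →ₗ[ℝ] Matrix (Fin 3) (Fin 3) ℝ where
  toFun v := (E * v).trace • vecMulVec ζ ζ + (ζ ⬝ᵥ E *ᵥ ζ) • v
      - vecMulVec ζ (v *ᵥ E *ᵥ ζ) - vecMulVec (v *ᵥ E *ᵥ ζ) ζ
  map_add' := by
    intro a b
    ext i j
    simp [vecMulVec_apply, mulVec, dotProduct, Matrix.trace, Matrix.diag,
      Matrix.mul_apply, Finset.sum_add_distrib, add_mul, mul_add]
    ring
  map_smul' := by
    intro c a
    have h1 : ∀ (u : Fin 3 → ℝ) (w : Fin 3 → ℝ),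
        vecMulVec u (c • w) = c • vecMulVec u w := by
      intro u w; ext i j; simp [vecMulVec_apply, mul_comm, mul_left_comm]
    have h2 : ∀ (u w : Fin 3 → ℝ), vecMulVec (c • u) w = c • vecMulVec u w := by
      intro u w; ext i j; simp [vecMulVec_apply, mul_assoc]
    simp only [Matrix.mul_smul, Matrix.trace_smul, Matrix.smul_mulVec,
      h1, h2, smul_eq_mul, RingHom.id_apply, smul_smul]
    module

lemma sigmaMap_mem (E : Matrix (Fin 3) (Fin 3) ℝ) (ζ : Fin 3 → ℝ) :
    ∀ v ∈ symMat3, sigmaMap E ζ v ∈ symMat3 := by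
  intro v hv
  have hv' : ∀ a b, v a b = v b a := fun a b => Matrix.IsSymm.apply hv b a
  show ((sigmaMap E ζ) v).IsSymm
  apply Matrix.IsSymm.ext
  intro i j
  simp only [sigmaMap, LinearMap.coe_mk, AddHom.coe_mk, Matrix.sub_apply,
    Matrix.add_apply, Matrix.smul_apply, vecMulVec_apply, smul_eq_mul,
    mulVec, dotProduct]
  rw [hv' j i]
  ring_nf

/-- The principal symbol of the linearization of the cross curvature operator,
as a linear endomorphism of the space of symmetric 3×3 matrices:
`σ_{E,ζ}(v) = tr(Ev)·ζζᵀ + (ζᵀEζ)·v − ζ(vEζ)ᵀ − (vEζ)ζᵀ`. -/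
noncomputable def sigmaEnd (E : Matrix (Fin 3) (Fin 3) ℝ) (ζ : Fin 3 → ℝ) :
    symMat3 →ₗ[ℝ] symMat3 :=
  (sigmaMap E ζ).restrict (sigmaMap_mem E ζ)


/-- The square of the symbol on all matrices (only the symmetry of `E` is needed). -/
lemma sigmaMap_sq (E : Matrix (Fin 3) (Fin 3) ℝ) (hE : E.IsSymm) (ζ : Fin 3 → ℝ)
    (v : Matrix (Fin 3) (Fin 3) ℝ) :
    sigmaMap E ζ (sigmaMap E ζ v) = (ζ ⬝ᵥ E *ᵥ ζ) • sigmaMap E ζ v := by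
  have key : ∀ u, sigmaMap E ζ u = (E * u).trace • vecMulVec ζ ζ + (ζ ⬝ᵥ E *ᵥ ζ) • u
      - vecMulVec ζ (u *ᵥ E *ᵥ ζ) - vecMulVec (u *ᵥ E *ᵥ ζ) ζ := fun _ => rfl
  have hsymm : ∀ a b : Fin 3 → ℝ, a ⬝ᵥ E *ᵥ b = b ⬝ᵥ E *ᵥ a := by
    intro a b
    rw [dotProduct_mulVec, ← mulVec_transpose, hE.eq, dotProduct_comm]
  have htr : ∀ a b : Fin 3 → ℝ, (E * vecMulVec a b).trace = b ⬝ᵥ E *ᵥ a := by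
    intro a b
    rw [mul_vecMulVec, trace_vecMulVec, dotProduct_comm]
  have hmv : ∀ a b c : Fin 3 → ℝ, vecMulVec a b *ᵥ c = (b ⬝ᵥ c) • a := by
    intro a b c
    ext i
    simp [vecMulVec_apply, mulVec, dotProduct, Fin.sum_univ_three]
    ring
  -- the vector `(σ v) E ζ` is a multiple of `ζ`
  have h1 : sigmaMap E ζ v *ᵥ E *ᵥ ζ = ((E * v).trace * (ζ ⬝ᵥ E *ᵥ ζ)
      - (v *ᵥ E *ᵥ ζ) ⬝ᵥ E *ᵥ ζ) • ζ := by
    rw [key, sub_mulVec, sub_mulVec, add_mulVec, smul_mulVec, smul_mulVec, hmv, hmv, hmv]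
    module
  have h2 : (E * sigmaMap E ζ v).trace = 2 * ((E * v).trace * (ζ ⬝ᵥ E *ᵥ ζ)
      - (v *ᵥ E *ᵥ ζ) ⬝ᵥ E *ᵥ ζ) := by
    rw [key, Matrix.mul_sub, Matrix.mul_sub, Matrix.mul_add, Matrix.mul_smul, Matrix.mul_smul,
      trace_sub, trace_sub, trace_add, trace_smul, trace_smul, htr, htr, htr,
      hsymm ζ (v *ᵥ E *ᵥ ζ), smul_eq_mul, smul_eq_mul]
    ring
  rw [key (sigmaMap E ζ v), h1, h2, vecMulVec_smul, smul_vecMulVec]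
  module

/-- `σ_{E,ζ} ∘ σ_{E,ζ} = (ζᵀEζ)·σ_{E,ζ}`; consequently every eigenvalue of
`σ_{E,ζ}` lies in `{0, ζᵀEζ}`, and if `ζᵀEζ ≥ 0` then all eigenvalues of
`σ_{E,ζ}` are nonnegative. -/
theorem sigma_symbol_sq_eq_smul_self
    (E : Matrix (Fin 3) (Fin 3) ℝ) (hE : E.IsSymm) (ζ : Fin 3 → ℝ) :
    sigmaEnd E ζ ∘ₗ sigmaEnd E ζ = (ζ ⬝ᵥ E *ᵥ ζ) • sigmaEnd E ζ
    ∧ (∀ μ : ℝ, Module.End.HasEigenvalue (sigmaEnd E ζ) μ →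
        μ = 0 ∨ μ = ζ ⬝ᵥ E *ᵥ ζ)
    ∧ (0 ≤ ζ ⬝ᵥ E *ᵥ ζ →
        ∀ μ : ℝ, Module.End.HasEigenvalue (sigmaEnd E ζ) μ → 0 ≤ μ) := by
  have hsq : sigmaEnd E ζ ∘ₗ sigmaEnd E ζ = (ζ ⬝ᵥ E *ᵥ ζ) • sigmaEnd E ζ := by
    ext1 v
    exact Subtype.ext (sigmaMap_sq E hE ζ v)
  have heig : ∀ μ : ℝ, Module.End.HasEigenvalue (sigmaEnd E ζ) μ →
      μ = 0 ∨ μ = ζ ⬝ᵥ E *ᵥ ζ := by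
    intro μ hμ
    obtain ⟨v, hv⟩ := hμ.exists_hasEigenvector
    have h := LinearMap.congr_fun hsq v
    rw [LinearMap.comp_apply, LinearMap.smul_apply, hv.apply_eq_smul, map_smul,
      hv.apply_eq_smul, smul_smul, smul_smul] at h
    have h' := smul_left_injective ℝ hv.2 h
    have h'' : μ * (μ - ζ ⬝ᵥ E *ᵥ ζ) = 0 := by
      linear_combination h'
    rcases mul_eq_zero.mp h'' with h0 | h0
    · exact Or.inl h0
    · exact Or.inr (sub_eq_zero.mp h0)
  refine ⟨hsq, heig, fun hs μ hμ => ?_⟩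
  rcases heig μ hμ with h | h
  · exact h.ge
  · exact h ▸ hs
end

section
/- Let ζ ∈ ℝ³ be a unit vector and let τ_ζ be the linear endomorphism of the real vector space of symmetric 3×3 matrices defined by τ_ζ(v) = (vζ)ζᵀ + ζ(vζ)ᵀ − (tr v)·ζζᵀ. Then τ_ζ ∘ τ_ζ = τ_ζ (τ_ζ is idempotent), its trace (as an endomorphism of the 6-dimensional space of symmetric matrices) is 3, and every eigenvalue of τ_ζ lies in {0, 1}. -/
open Matrix

/-- The map `v ↦ (vζ)ζᵀ + ζ(vζ)ᵀ − (tr v)·ζζᵀ` on 3×3 matrices, as a linear map. -/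
noncomputable def tauMap (ζ : Fin 3 → ℝ) :
    Matrix (Fin 3) (Fin 3) ℝ →ₗ[ℝ] Matrix (Fin 3) (Fin 3) ℝ where
  toFun v := vecMulVec (v *ᵥ ζ) ζ + vecMulVec ζ (v *ᵥ ζ) - v.trace • vecMulVec ζ ζ
  map_add' := by
    intro a b
    ext i j
    simp [vecMulVec_apply, mulVec, dotProduct, Matrix.trace, Matrix.diag,
      Finset.sum_add_distrib, add_mul, mul_add]
    ring
  map_smul' := by
    intro c a
    have h1 : ∀ (u : Fin 3 → ℝ) (w : Fin 3 → ℝ),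
        vecMulVec u (c • w) = c • vecMulVec u w := by
      intro u w; ext i j; simp [vecMulVec_apply, mul_comm, mul_left_comm]
    have h2 : ∀ (u w : Fin 3 → ℝ), vecMulVec (c • u) w = c • vecMulVec u w := by
      intro u w; ext i j; simp [vecMulVec_apply, mul_assoc]
    simp only [Matrix.trace_smul, Matrix.smul_mulVec, h1, h2,
      smul_eq_mul, RingHom.id_apply, smul_smul]
    module

lemma tauMap_mem (ζ : Fin 3 → ℝ) : ∀ v ∈ symMat3, tauMap ζ v ∈ symMat3 := by
  intro v hv
  have hv' : ∀ a b, v a b = v b a := fun a b => Matrix.IsSymm.apply hv b a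
  show ((tauMap ζ) v).IsSymm
  apply Matrix.IsSymm.ext
  intro i j
  simp only [tauMap, LinearMap.coe_mk, AddHom.coe_mk, Matrix.sub_apply,
    Matrix.add_apply, Matrix.smul_apply, vecMulVec_apply, smul_eq_mul,
    mulVec, dotProduct]
  ring

/-- The principal symbol of the linearization of the DeTurck operator,
as a linear endomorphism of the space of symmetric 3×3 matrices:
`τ_ζ(v) = (vζ)ζᵀ + ζ(vζ)ᵀ − (tr v)·ζζᵀ`. -/
noncomputable def tauEnd (ζ : Fin 3 → ℝ) : symMat3 →ₗ[ℝ] symMat3 :=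
  (tauMap ζ).restrict (tauMap_mem ζ)

lemma tau_factor (ζ : Fin 3 → ℝ) (hζ : ζ ⬝ᵥ ζ = 1) :
    ∃ (A : symMat3 →ₗ[ℝ] (Fin 3 → ℝ)) (B : (Fin 3 → ℝ) →ₗ[ℝ] symMat3),
      B ∘ₗ A = tauEnd ζ ∧ A ∘ₗ B = LinearMap.id := by
  have hz : ζ 0 * ζ 0 + ζ 1 * ζ 1 + ζ 2 * ζ 2 = 1 := by
    simpa [dotProduct, Fin.sum_univ_three] using hζ
  let A : symMat3 →ₗ[ℝ] (Fin 3 → ℝ) :=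
    { toFun := fun v => v.1 *ᵥ ζ - (v.1.trace / 2) • ζ
      map_add' := by
        intro a b
        simp only [Submodule.coe_add, Matrix.add_mulVec, Matrix.trace_add]
        module
      map_smul' := by
        intro c a
        simp only [Submodule.coe_smul, Matrix.smul_mulVec, Matrix.trace_smul, smul_eq_mul,
          RingHom.id_apply]
        module }
  let B : (Fin 3 → ℝ) →ₗ[ℝ] symMat3 :=
    { toFun := fun w => ⟨vecMulVec w ζ + vecMulVec ζ w, by
        apply Matrix.IsSymm.ext
        intro i j
        simp only [Matrix.add_apply, vecMulVec_apply]
        ring⟩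
      map_add' := by
        intro a b
        ext i j
        simp [vecMulVec_apply]
        ring
      map_smul' := by
        intro c a
        ext i j
        simp [vecMulVec_apply]
        ring }
  refine ⟨A, B, ?_, ?_⟩
  · apply LinearMap.ext
    intro v
    apply Subtype.ext
    ext i j
    simp only [A, B, tauEnd, tauMap, LinearMap.comp_apply, LinearMap.coe_mk, AddHom.coe_mk,
      LinearMap.restrict_coe_apply, Matrix.add_apply, Matrix.sub_apply, Matrix.smul_apply,
      vecMulVec_apply, Pi.sub_apply, Pi.smul_apply, smul_eq_mul]
    ring
  · apply LinearMap.ext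
    intro w
    ext i
    simp only [A, B, LinearMap.comp_apply, LinearMap.coe_mk, AddHom.coe_mk, LinearMap.id_apply,
      Matrix.add_apply, vecMulVec_apply, Pi.sub_apply, Pi.smul_apply, smul_eq_mul,
      mulVec, dotProduct, Matrix.trace, Matrix.diag, Fin.sum_univ_three]
    linear_combination (w i) * hz

/-- For a unit vector `ζ`, the symbol `τ_ζ` of the DeTurck operator is idempotent,
has trace `3` as an endomorphism of the 6-dimensional space of symmetric 3×3
matrices, and every eigenvalue of `τ_ζ` lies in `{0, 1}`. -/
theorem tau_symbol_idempotent_trace_eigenvalues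
    (ζ : Fin 3 → ℝ) (hζ : ζ ⬝ᵥ ζ = 1) :
    tauEnd ζ ∘ₗ tauEnd ζ = tauEnd ζ
    ∧ LinearMap.trace ℝ symMat3 (tauEnd ζ) = 3
    ∧ (∀ μ : ℝ, Module.End.HasEigenvalue (tauEnd ζ) μ → μ = 0 ∨ μ = 1) := by
  obtain ⟨A, B, h1, h2⟩ := tau_factor ζ hζ
  have hid : tauEnd ζ ∘ₗ tauEnd ζ = tauEnd ζ := by
    rw [← h1, LinearMap.comp_assoc, ← LinearMap.comp_assoc A B A, h2, LinearMap.id_comp]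
  refine ⟨hid, ?_, ?_⟩
  · rw [← h1, LinearMap.trace_comp_comm', h2, LinearMap.trace_id]
    simp
  · intro μ hμ
    obtain ⟨v, hv⟩ := hμ.exists_hasEigenvector
    have e := hv.apply_eq_smul
    have e2 : tauEnd ζ (tauEnd ζ v) = tauEnd ζ v := LinearMap.congr_fun hid v
    rw [e, map_smul, e, smul_smul] at e2
    have h := smul_left_injective ℝ hv.2 e2
    have h' : μ * (μ - 1) = 0 := by
      have h3 : μ * μ = μ := h
      linarith
    rcases mul_eq_zero.mp h' with h | h
    · exact Or.inl h
    · exact Or.inr (by linarith)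
end

section
/- Let E be a symmetric 3×3 real matrix and ζ ∈ ℝ³ a unit vector. On the real vector space of symmetric 3×3 matrices, consider the linear map L = σ_{E,ζ} + τ_ζ, where σ_{E,ζ}(v) = tr(Ev)·ζζᵀ + (ζᵀEζ)·v − ζ(vEζ)ᵀ − (vEζ)ζᵀ and τ_ζ(v) = (vζ)ζᵀ + ζ(vζ)ᵀ − (tr v)·ζζᵀ. Then the characteristic polynomial of L is (X−1)³(X−ζᵀEζ)³. In particular, if ζᵀEζ > 0 then all eigenvalues of L are positive and L is invertible. -/
open Matrix

/-- Coordinates on symmetric matrices. -/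
noncomputable def symEquiv : symMat3 ≃ₗ[ℝ] (Fin 6 → ℝ) where
  toFun v := ![v.1 0 0, v.1 0 1, v.1 0 2, v.1 1 1, v.1 1 2, v.1 2 2]
  map_add' a b := by
    ext i; fin_cases i <;> simp
  map_smul' c a := by
    ext i; fin_cases i <;> simp
  invFun w := ⟨!![w 0, w 1, w 2; w 1, w 3, w 4; w 2, w 4, w 5], by
    apply Matrix.IsSymm.ext
    intro i j
    fin_cases i <;> fin_cases j <;> simp⟩
  left_inv v := by
    have hv : ∀ a b, v.1 a b = v.1 b a := fun a b => Matrix.IsSymm.apply v.2 b a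
    ext i j
    fin_cases i <;> fin_cases j <;> simp [hv 1 0, hv 2 0, hv 2 1]
  right_inv w := by
    ext i; fin_cases i <;> simp

/-- The map `w ↦ ζwᵀ + wζᵀ`. -/
noncomputable def iotaMap (ζ : Fin 3 → ℝ) : (Fin 3 → ℝ) →ₗ[ℝ] symMat3 where
  toFun w := ⟨vecMulVec ζ w + vecMulVec w ζ, by
    apply Matrix.IsSymm.ext
    intro i j
    simp [vecMulVec_apply]; ring⟩
  map_add' a b := by
    ext i j
    simp [vecMulVec_apply]; ring
  map_smul' c a := by
    ext i j
    simp [vecMulVec_apply]; ring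

/-- The map `v ↦ ½(tr(Ev) - tr v)ζ + vζ - vEζ`. -/
noncomputable def phiMap (E : Matrix (Fin 3) (Fin 3) ℝ) (ζ : Fin 3 → ℝ) :
    symMat3 →ₗ[ℝ] (Fin 3 → ℝ) where
  toFun v := (((E * v.1).trace - v.1.trace) / 2) • ζ + v.1 *ᵥ ζ - v.1 *ᵥ E *ᵥ ζ
  map_add' a b := by
    ext i
    simp [Matrix.mul_add, Matrix.add_mulVec, -Matrix.mulVec_mulVec]; ring
  map_smul' c a := by
    ext i
    simp [Matrix.smul_mulVec]; ring

lemma sub_eq_comp (E : Matrix (Fin 3) (Fin 3) ℝ) (ζ : Fin 3 → ℝ) :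
    sigmaEnd E ζ + tauEnd ζ
      = iotaMap ζ ∘ₗ phiMap E ζ - (-(ζ ⬝ᵥ E *ᵥ ζ)) • (1 : Module.End ℝ symMat3) := by
  ext v i j
  simp [sigmaEnd, tauEnd, sigmaMap, tauMap, iotaMap, phiMap, vecMulVec_apply]
  ring

lemma phi_comp_iota (E : Matrix (Fin 3) (Fin 3) ℝ) (hE : E.IsSymm) (ζ : Fin 3 → ℝ)
    (hζ : ζ ⬝ᵥ ζ = 1) :
    phiMap E ζ ∘ₗ iotaMap ζ = (1 - ζ ⬝ᵥ E *ᵥ ζ) • LinearMap.id := by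
  apply LinearMap.ext
  intro w
  have h1 : (E * vecMulVec ζ w).trace = w ⬝ᵥ E *ᵥ ζ := by
    rw [Matrix.mul_vecMulVec, Matrix.trace_vecMulVec, dotProduct_comm]
  have h2 : (E * vecMulVec w ζ).trace = w ⬝ᵥ E *ᵥ ζ := by
    rw [Matrix.mul_vecMulVec, Matrix.trace_vecMulVec, dotProduct_comm, Matrix.dotProduct_mulVec,
      ← Matrix.mulVec_transpose, hE.eq, dotProduct_comm]
  ext i
  simp [phiMap, iotaMap, Matrix.mul_add, Matrix.add_mulVec, h1, h2, Matrix.trace_vecMulVec,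
    Matrix.vecMulVec_mulVec, hζ, dotProduct_comm ζ w, -Matrix.mulVec_mulVec]
  ring

/-- For symmetric `E` and unit `ζ`, the characteristic polynomial of
`L = σ_{E,ζ} + τ_ζ` (as an endomorphism of the space of symmetric 3×3 matrices)
is `(X−1)³ (X−ζᵀEζ)³`; in particular, if `ζᵀEζ > 0` then all eigenvalues of `L`
are positive and `L` is invertible. -/
theorem modified_symbol_charpoly
    (E : Matrix (Fin 3) (Fin 3) ℝ) (hE : E.IsSymm) (ζ : Fin 3 → ℝ)
    (hζ : ζ ⬝ᵥ ζ = 1) :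
    LinearMap.charpoly (sigmaEnd E ζ + tauEnd ζ)
      = (Polynomial.X - 1) ^ 3
        * (Polynomial.X - Polynomial.C (ζ ⬝ᵥ E *ᵥ ζ)) ^ 3
    ∧ (0 < ζ ⬝ᵥ E *ᵥ ζ →
        (∀ μ : ℝ, Module.End.HasEigenvalue (sigmaEnd E ζ + tauEnd ζ) μ → 0 < μ)
        ∧ Function.Bijective (sigmaEnd E ζ + tauEnd ζ)) := by
  have hchar : LinearMap.charpoly (sigmaEnd E ζ + tauEnd ζ)
      = (Polynomial.X - 1) ^ 3
        * (Polynomial.X - Polynomial.C (ζ ⬝ᵥ E *ᵥ ζ)) ^ 3 := by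
    let b : Module.Basis (Fin 6) ℝ symMat3 := Module.Basis.ofEquivFun symEquiv
    let b' := Pi.basisFun ℝ (Fin 3)
    have h : LinearMap.charpoly (iotaMap ζ ∘ₗ phiMap E ζ)
        = Polynomial.X ^ 3 * (Polynomial.X - Polynomial.C (1 - ζ ⬝ᵥ E *ᵥ ζ)) ^ 3 := by
      rw [← LinearMap.charpoly_toMatrix _ b, LinearMap.toMatrix_comp b b' b,
        Matrix.charpoly_mul_comm_of_le _ _ (by simp), ← LinearMap.toMatrix_comp b' b b',
        phi_comp_iota E hE ζ hζ, map_smul, LinearMap.toMatrix_id, Matrix.smul_one_eq_diagonal,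
        Matrix.charpoly_diagonal]
      simp
    rw [sub_eq_comp, LinearMap.charpoly_sub_smul, h]
    simp
    ring
  refine ⟨hchar, fun hc => ?_⟩
  have hpos : ∀ μ : ℝ, Module.End.HasEigenvalue (sigmaEnd E ζ + tauEnd ζ) μ → 0 < μ := by
    intro μ hμ
    rw [Module.End.hasEigenvalue_iff_isRoot_charpoly, hchar] at hμ
    simp [Polynomial.IsRoot, sub_eq_zero] at hμ
    rcases hμ with h | h
    · rw [h]; exact one_pos
    · rw [h]; exact hc
  refine ⟨hpos, ?_⟩
  have : FiniteDimensional ℝ symMat3 := inferInstance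
  have hinj : Function.Injective (sigmaEnd E ζ + tauEnd ζ) := by
    rw [← LinearMap.ker_eq_bot]
    by_contra hk
    refine lt_irrefl _ (hpos 0 ?_)
    rw [Module.End.hasEigenvalue_iff, Module.End.eigenspace_zero]
    exact hk
  exact ⟨hinj, LinearMap.injective_iff_surjective.mp hinj⟩
end

section
/- Let E be a symmetric 3×3 real matrix and ζ ∈ ℝ³ with ζᵀEζ < 0. Let σ_{E,ζ} be the linear endomorphism of the real vector space of symmetric 3×3 matrices defined by σ_{E,ζ}(v) = tr(Ev)·ζζᵀ + (ζᵀEζ)·v − ζ(vEζ)ᵀ − (vEζ)ζᵀ. Then every eigenvalue of −σ_{E,ζ} lies in {0, −ζᵀEζ}; in particular all eigenvalues of −σ_{E,ζ} are nonnegative. -/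
open Matrix

/-- The eigenvalue equation for the symbol forces `l = 0` or `l = ζᵀEζ`. -/
lemma sigma_aux (E : Matrix (Fin 3) (Fin 3) ℝ) (hE : E.IsSymm) (ζ : Fin 3 → ℝ)
    (v : Matrix (Fin 3) (Fin 3) ℝ) (hv0 : v ≠ 0) (l : ℝ)
    (h : sigmaMap E ζ v = l • v) : l = 0 ∨ l = ζ ⬝ᵥ E *ᵥ ζ := by
  by_contra! hcon
  obtain ⟨hl0, hlq⟩ := hcon
  have h' : (E * v).trace • vecMulVec ζ ζ + (ζ ⬝ᵥ E *ᵥ ζ) • v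
      - vecMulVec ζ (v *ᵥ E *ᵥ ζ) - vecMulVec (v *ᵥ E *ᵥ ζ) ζ = l • v := h
  have hEw : ∀ x : Fin 3 → ℝ, (E *ᵥ x) ⬝ᵥ ζ = x ⬝ᵥ E *ᵥ ζ := by
    intro x
    rw [dotProduct_comm, dotProduct_mulVec, ← mulVec_transpose, hE.eq, dotProduct_comm]
  have hA : l • (v *ᵥ E *ᵥ ζ) = ((E * v).trace * (ζ ⬝ᵥ E *ᵥ ζ)
      - (v *ᵥ E *ᵥ ζ) ⬝ᵥ E *ᵥ ζ) • ζ := by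
    have := congrArg (fun M => M *ᵥ (E *ᵥ ζ)) h'
    simp only [sub_mulVec, add_mulVec, smul_mulVec, vecMulVec_mulVec, op_smul_eq_smul] at this
    rw [← this]
    module
  have hT : l * (E * v).trace = 2 * ((E * v).trace * (ζ ⬝ᵥ E *ᵥ ζ)
      - (v *ᵥ E *ᵥ ζ) ⬝ᵥ E *ᵥ ζ) := by
    have := congrArg (fun M => (E * M).trace) h'
    simp only [mul_sub, mul_add, Matrix.mul_smul, mul_vecMulVec, trace_sub, trace_add,
      trace_smul, trace_vecMulVec, smul_eq_mul, hEw] at this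
    rw [dotProduct_comm (E *ᵥ ζ) (v *ᵥ E *ᵥ ζ)] at this
    linarith
  have hS := congrArg (fun x => x ⬝ᵥ E *ᵥ ζ) hA
  simp only [smul_dotProduct, smul_eq_mul] at hS
  generalize (v *ᵥ E *ᵥ ζ) ⬝ᵥ E *ᵥ ζ = s at *
  generalize v *ᵥ E *ᵥ ζ = w at *
  generalize (E * v).trace = t at *
  generalize ζ ⬝ᵥ E *ᵥ ζ = q at *
  have hd : t * q - s = 0 := by
    have : (l - q) * (t * q - s) = 0 := by linear_combination q * hT - hS
    exact (mul_eq_zero.mp this).resolve_left (sub_ne_zero.mpr hlq)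
  rw [hd] at hA hT
  have ht : t = 0 := by simpa [hl0] using hT
  have hw : w = 0 := by simpa [hl0] using hA
  subst ht hw
  have hz : (l - q) • v = 0 := by
    rw [sub_smul, ← h']
    simp
  exact (smul_eq_zero.mp hz).elim (sub_ne_zero.mpr hlq) hv0

/-- If `ζᵀEζ < 0`, every eigenvalue of `−σ_{E,ζ}` lies in `{0, −ζᵀEζ}`;
in particular all eigenvalues of `−σ_{E,ζ}` are nonnegative. -/
theorem neg_sigma_symbol_eigenvalues_nonneg
    (E : Matrix (Fin 3) (Fin 3) ℝ) (hE : E.IsSymm) (ζ : Fin 3 → ℝ)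
    (hneg : ζ ⬝ᵥ E *ᵥ ζ < 0) :
    (∀ μ : ℝ, Module.End.HasEigenvalue (-(sigmaEnd E ζ)) μ →
        μ = 0 ∨ μ = -(ζ ⬝ᵥ E *ᵥ ζ))
    ∧ (∀ μ : ℝ, Module.End.HasEigenvalue (-(sigmaEnd E ζ)) μ → 0 ≤ μ) := by
  have key : ∀ μ : ℝ, Module.End.HasEigenvalue (-(sigmaEnd E ζ)) μ →
        μ = 0 ∨ μ = -(ζ ⬝ᵥ E *ᵥ ζ) := by
    intro μ hμ
    obtain ⟨v, hv⟩ := hμ.exists_hasEigenvector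
    have h1 := congrArg (Subtype.val) hv.apply_eq_smul
    have h2 : -(sigmaMap E ζ v.1) = μ • v.1 := h1
    have h3 : sigmaMap E ζ v.1 = (-μ) • v.1 := by
      rw [neg_smul, ← h2, neg_neg]
    have hv0 : v.1 ≠ 0 := fun h => hv.2 (Subtype.ext h)
    rcases sigma_aux E hE ζ v.1 hv0 _ h3 with h | h
    · left; linarith
    · right; linarith
  refine ⟨key, fun μ hμ => ?_⟩
  rcases key μ hμ with h | h <;> linarith
end
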